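/- For finite-dimensional Hilbert spaces, a quantum channel ℰ_{B→B̃} is an exact local compression of a bipartite density operator ρ_{AB} (i.e., there exists a channel ℛ_{B̃→B} with (ℛ∘ℰ)(ρ_{AB}) = ρ_{AB}) if and only if the mutual information is preserved: I(A:B)_ρ = I(A:B̃)_{ℰ(ρ)}. -/

import Mathlib

open scoped ComplexOrder
open Matrix

/-- Von Neumann entropy `S(M) = -Σ λᵢ log λᵢ` of a (Hermitian) matrix, via its eigenvalues
(junk value 0 if `M` is not Hermitian). -/
noncomputable def vNent {n : Type*} [Fintype n] [DecidableEq n] (M : Matrix n n ℂ) : ℝ :=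
  if h : M.IsHermitian then -∑ i, h.eigenvalues i * Real.log (h.eigenvalues i) else 0

/-- Partial trace over the second tensor factor. -/
noncomputable def ptraceB {A B : Type*} [Fintype A] [Fintype B]
    (M : Matrix (A × B) (A × B) ℂ) : Matrix A A ℂ :=
  Matrix.of fun i j => ∑ b, M (i, b) (j, b)

/-- Partial trace over the first tensor factor. -/
noncomputable def ptraceA {A B : Type*} [Fintype A] [Fintype B]
    (M : Matrix (A × B) (A × B) ℂ) : Matrix B B ℂ :=
  Matrix.of fun b c => ∑ i, M (i, b) (i, c)

/-- Mutual information `I(A:B) = S(ρ_A) + S(ρ_B) − S(ρ_{AB})`. -/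
noncomputable def mutInfo {A B : Type*} [Fintype A] [Fintype B] [DecidableEq A] [DecidableEq B]
    (M : Matrix (A × B) (A × B) ℂ) : ℝ :=
  vNent (ptraceB M) + vNent (ptraceA M) - vNent M

/-- A quantum channel (CPTP map), in finite dimension: a map admitting a Kraus representation
`Φ(X) = Σ_k K_k X K_k†` with `Σ_k K_k† K_k = 1`. -/
def IsCPTP {B B' : Type*} [Fintype B] [Fintype B'] [DecidableEq B]
    (Φ : Matrix B B ℂ → Matrix B' B' ℂ) : Prop :=
  ∃ (κ : ℕ) (K : Fin κ → Matrix B' B ℂ),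
    (∀ X, Φ X = ∑ k, K k * X * (K k)ᴴ) ∧ (∑ k, (K k)ᴴ * K k = 1)

/-- The extension `id_A ⊗ Φ` of a map on the `B` factor to the bipartite system. -/
noncomputable def extA {A B B' : Type*} [Fintype A] [Fintype B] [Fintype B']
    (Φ : Matrix B B ℂ → Matrix B' B' ℂ)
    (X : Matrix (A × B) (A × B) ℂ) : Matrix (A × B') (A × B') ℂ :=
  Matrix.of fun p q => Φ (Matrix.of fun b c => X (p.1, b) (q.1, c)) p.2 q.2

section RelativeEntropy

/-- On a finite set of nonnegative reals, the square root is a linear combination of the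
functions `r ↦ r / (1 + t r)` with `t > 0`. -/
lemma exists_sum_resolvent_eq_sqrt (R : Finset ℝ) (hR : ∀ r ∈ R, 0 ≤ r) :
    ∃ (T : Finset ℝ) (c : ℝ → ℝ), (∀ t ∈ T, 0 < t) ∧
      ∀ r ∈ R, ∑ t ∈ T, c t * (r / (1 + t * r)) = √r := by
  classical
  set R' := R.filter (0 < ·) with hR'
  have hpos : ∀ s ∈ R', 0 < s := fun s hs => (Finset.mem_filter.1 hs).2
  set N : ℝ → ℝ := fun r => ∏ s ∈ R', (s + r) with hN
  set P : Polynomial ℝ := Lagrange.interpolate R' id (fun r => (√r)⁻¹ * N r) with hP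
  have hPeval : ∀ r ∈ R', P.eval r = (√r)⁻¹ * N r := fun r hr => by
    exact Lagrange.eval_interpolate_at_node (s := R') (v := id)
      (fun r => (√r)⁻¹ * N r) (Function.injective_id.injOn) hr
  have hdeg : P.degree < R'.card := Lagrange.degree_interpolate_lt _ Function.injective_id.injOn
  have hneg : Set.InjOn (fun s : ℝ => -s) R' := neg_injective.injOn
  have hPeq := Lagrange.eq_interpolate hneg hdeg
  refine ⟨R'.image (·⁻¹),
    fun t => t * (P.eval (-t⁻¹) * ∏ u ∈ R'.erase t⁻¹, (u - t⁻¹)⁻¹), ?_, ?_⟩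
  · intro t ht
    obtain ⟨s, hs, rfl⟩ := Finset.mem_image.1 ht
    exact inv_pos.2 (hpos s hs)
  · intro r hr
    rcases (hR r hr).eq_or_lt with h0 | h0
    · simp [← h0]
    have hr' : r ∈ R' := Finset.mem_filter.2 ⟨hr, h0⟩
    have hN0 : N r ≠ 0 := Finset.prod_ne_zero_iff.2 fun s hs => by linarith [hpos s hs]
    have key : P.eval r = ∑ s ∈ R', P.eval (-s) * ((∏ u ∈ R'.erase s, (u - s)⁻¹) *
        (N r / (s + r))) := by
      conv_lhs => rw [hPeq]
      rw [Lagrange.interpolate_apply, Polynomial.eval_finsetSum]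
      refine Finset.sum_congr rfl fun s hs => ?_
      have hsr : s + r ≠ 0 := by linarith [hpos s hs]
      have : N r / (s + r) = ∏ u ∈ R'.erase s, (u + r) := by
        rw [div_eq_iff hsr]
        exact (Finset.prod_erase_mul _ _ hs).symm
      rw [this, Lagrange.basis, Polynomial.eval_mul, Polynomial.eval_C, Polynomial.eval_prod,
        ← Finset.prod_mul_distrib]
      congr 1
      refine Finset.prod_congr rfl fun u _ => ?_
      simp only [Lagrange.basisDivisor, Polynomial.eval_mul, Polynomial.eval_C,
        Polynomial.eval_sub, Polynomial.eval_X]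
      congr 1
      · congr 1; ring
      · ring
    rw [Finset.sum_image fun _ _ _ _ h => inv_injective h]
    simp only [inv_inv]
    have hs2 : √r = r * P.eval r / N r := by
      rw [hPeval r hr']
      have h3 : √r ≠ 0 := (Real.sqrt_pos.2 h0).ne'
      field_simp
      exact Real.sq_sqrt h0.le
    rw [hs2, key, Finset.mul_sum, Finset.sum_div]
    refine Finset.sum_congr rfl fun s hs => ?_
    have hs0 := (hpos s hs).ne'
    have hsr : s + r ≠ 0 := by linarith [hpos s hs]
    have : 1 + s⁻¹ * r = (s + r) / s := by field_simp
    rw [this]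
    field_simp

/-- A function on `[0, ∞)` with nonnegative derivative stays below its limit at infinity,
strictly so at `0` unless the derivative vanishes identically. -/
lemma le_limit_of_deriv_nonneg {h h' : ℝ → ℝ} {l : ℝ}
    (hd : ∀ t, 0 ≤ t → HasDerivAt h (h' t) t) (h0 : ∀ t, 0 ≤ t → 0 ≤ h' t)
    (hl : Filter.Tendsto h Filter.atTop (nhds l)) :
    h 0 ≤ l ∧ (h 0 = l → ∀ t, 0 < t → h' t = 0) := by
  have hmono : MonotoneOn h (Set.Ici 0) := by
    refine monotoneOn_of_deriv_nonneg (convex_Ici 0)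
      (fun t ht => (hd t ht).continuousAt.continuousWithinAt) ?_ ?_
    · intro t ht
      rw [interior_Ici] at ht
      exact (hd t (le_of_lt ht)).differentiableAt.differentiableWithinAt
    · intro t ht
      rw [interior_Ici] at ht
      rw [(hd t (le_of_lt ht)).deriv]
      exact h0 t (le_of_lt ht)
  have hle : ∀ t, 0 ≤ t → h t ≤ l := fun t ht =>
    ge_of_tendsto hl (Filter.eventually_atTop.2 ⟨t, fun s hs =>
      hmono (Set.mem_Ici.2 ht) (Set.mem_Ici.2 (ht.trans hs)) hs⟩)
  refine ⟨hle 0 le_rfl, fun heq t ht => ?_⟩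
  have hconst : h =ᶠ[nhds t] fun _ => l := by
    filter_upwards [lt_mem_nhds ht] with s hs
    exact le_antisymm (hle s (le_of_lt hs))
      (heq ▸ hmono (Set.mem_Ici.2 le_rfl) (Set.mem_Ici.2 (le_of_lt hs)) (le_of_lt hs))
  exact (hd t ht.le).unique ((hasDerivAt_const t l).congr_of_eventuallyEq hconst)

variable {m n κ : Type*} [Fintype m] [Fintype n] [Fintype κ]

lemma re_trace_conjTranspose_mul_self_nonneg (M : Matrix m n ℂ) : 0 ≤ (Mᴴ * M).trace.re :=
  (Complex.le_def.1 (posSemidef_conjTranspose_mul_self M).trace_nonneg).1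

lemma eq_zero_of_re_trace_conjTranspose_mul_self {M : Matrix m n ℂ}
    (h : (Mᴴ * M).trace.re = 0) : M = 0 := by
  rw [← trace_conjTranspose_mul_self_eq_zero_iff]
  exact Complex.ext h
    (Complex.le_def.1 (posSemidef_conjTranspose_mul_self M).trace_nonneg).2.symm

lemma re_trace_of_resolvent_eq {ρ σ X : Matrix m m ℂ} {t : ℝ} (hρ : ρ.IsHermitian)
    (hX : σ * X + (t : ℂ) • (X * ρ) = ρ) (Z : Matrix m m ℂ) :
    (Zᴴ * σ * X).trace.re + t * (X * ρ * Zᴴ).trace.re = (Z * ρ).trace.re := by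
  have h := congrArg (fun M => (Zᴴ * M).trace.re) hX
  simp only [Matrix.mul_add, Matrix.mul_smul, trace_add, trace_smul, Complex.add_re,
    smul_eq_mul, Complex.re_ofReal_mul, ← Matrix.mul_assoc] at h
  have h2 : (Zᴴ * ρ).trace.re = (Z * ρ).trace.re := by
    rw [← hρ.eq, ← conjTranspose_mul, trace_conjTranspose, trace_mul_comm, hρ.eq]
    simp
  rw [← h2, ← h, trace_mul_cycle X ρ Zᴴ]

/-- Completing the square in the variational formula for the resolvent of the relative modular
operator, pulled back along a channel with Kraus operators `L`. -/
lemma trace_resolvent_sub [DecidableEq m] (L : κ → Matrix n m ℂ) (hL : ∑ k, (L k)ᴴ * L k = 1)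
    {ρ σ X : Matrix m m ℂ} {ρ' σ' X' : Matrix n n ℂ} (t : ℝ)
    (hρ : ρ.IsHermitian) (hσ : σ.IsHermitian) (hρ'h : ρ'.IsHermitian)
    (hρ' : ρ' = ∑ k, L k * ρ * (L k)ᴴ) (hσ' : σ' = ∑ k, L k * σ * (L k)ᴴ)
    (hX : σ * X + (t : ℂ) • (X * ρ) = ρ) (hX' : σ' * X' + (t : ℂ) • (X' * ρ') = ρ')
    (Y : Matrix m m ℂ) (hY : Y = ∑ k, (L k)ᴴ * X' * L k) :
    (X * ρ).trace.re - (X' * ρ').trace.re =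
      ((Y - X)ᴴ * σ * (Y - X)).trace.re + t * ((Y - X) * ρ * (Y - X)ᴴ).trace.re
      + ∑ k, ((X'ᴴ * L k - L k * Yᴴ) * σ * (X'ᴴ * L k - L k * Yᴴ)ᴴ).trace.re
      + t * ∑ k, ((X' * L k - L k * Y) * ρ * (X' * L k - L k * Y)ᴴ).trace.re := by
  have hYh : Yᴴ = ∑ k, (L k)ᴴ * X'ᴴ * L k := by
    rw [hY, conjTranspose_sum]
    simp [Matrix.mul_assoc]
  have swap : ∀ (Z : Matrix n n ℂ) (M : Matrix m m ℂ),
      (Z * ∑ k, L k * M * (L k)ᴴ).trace = ((∑ k, (L k)ᴴ * Z * L k) * M).trace := by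
    intro Z M
    rw [Finset.mul_sum, Finset.sum_mul, trace_sum, trace_sum]
    refine Finset.sum_congr rfl fun k _ => ?_
    rw [← Matrix.mul_assoc, ← Matrix.mul_assoc, trace_mul_comm]
    simp [Matrix.mul_assoc]
  have one : ∀ (M : Matrix m m ℂ), (∑ k, (L k * M * (L k)ᴴ)).trace = M.trace := by
    intro M
    rw [trace_sum, Finset.sum_congr rfl fun k _ => (trace_mul_comm (L k * M) (L k)ᴴ), ← trace_sum]
    simp_rw [← Matrix.mul_assoc]
    rw [← Finset.sum_mul, hL, Matrix.one_mul]
  have general : ∀ (Z : Matrix n n ℂ) (W M : Matrix m m ℂ), W = ∑ k, (L k)ᴴ * Z * L k →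
      M.IsHermitian →
      ∑ k, ((Z * L k - L k * W) * M * (Z * L k - L k * W)ᴴ).trace.re =
        (Zᴴ * Z * ∑ k, L k * M * (L k)ᴴ).trace.re - (W * M * Wᴴ).trace.re := by
    intro Z W M hW hM
    have hWh : Wᴴ = ∑ k, (L k)ᴴ * Zᴴ * L k := by
      rw [hW, conjTranspose_sum]
      simp [Matrix.mul_assoc]
    have e1 : ∀ k, (Z * L k - L k * W) * M * (Z * L k - L k * W)ᴴ =
        Z * (L k * M * (L k)ᴴ) * Zᴴ - Z * (L k * (M * Wᴴ) * (L k)ᴴ)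
          - (L k * (W * M) * (L k)ᴴ) * Zᴴ + L k * (W * M * Wᴴ) * (L k)ᴴ := by
      intro k
      simp only [conjTranspose_sub, conjTranspose_mul, Matrix.sub_mul, Matrix.mul_sub,
        Matrix.mul_assoc]
      abel
    have e2 : (∑ k, (Z * L k - L k * W) * M * (Z * L k - L k * W)ᴴ).trace =
        (Zᴴ * Z * ∑ k, L k * M * (L k)ᴴ).trace - (W * M * Wᴴ).trace := by
      simp_rw [e1]
      rw [Finset.sum_add_distrib, Finset.sum_sub_distrib, Finset.sum_sub_distrib,
        ← Finset.sum_mul, ← Finset.mul_sum, ← Finset.mul_sum, ← Finset.sum_mul,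
        trace_add, trace_sub, trace_sub, one, swap, ← hW, trace_mul_comm (∑ k, _ ) Zᴴ, swap, ← hWh,
        trace_mul_comm (Z * _) Zᴴ, ← Matrix.mul_assoc Zᴴ, trace_mul_comm Wᴴ, Matrix.mul_assoc W]
      ring
    rw [← Complex.re_sum, ← trace_sum, e2, Complex.sub_re]
  rw [general X' Y ρ hY hρ]
  have g2 := general X'ᴴ Yᴴ σ hYh hσ
  simp only [conjTranspose_conjTranspose] at g2 ⊢
  rw [g2, ← hρ', ← hσ']
  have hre : ∀ (M : Matrix m m ℂ), (Mᴴ).trace.re = M.trace.re := fun M => by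
    rw [trace_conjTranspose]; simp
  have hlin : (Y * ρ).trace.re = (X' * ρ').trace.re := by rw [hρ', swap, ← hY]
  have a2 : (X' * X'ᴴ * σ').trace.re + t * (X'ᴴ * X' * ρ').trace.re = (X' * ρ').trace.re := by
    rw [← re_trace_of_resolvent_eq hρ'h hX' X', trace_mul_cycle X' ρ', trace_mul_cycle X'ᴴ σ']
  have c1 : (Xᴴ * σ * Y).trace.re = (Yᴴ * σ * X).trace.re := by
    rw [← hre, conjTranspose_mul, conjTranspose_mul, hσ.eq, conjTranspose_conjTranspose,
      Matrix.mul_assoc]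
  have c2 : (Y * ρ * Xᴴ).trace.re = (X * ρ * Yᴴ).trace.re := by
    rw [← hre, conjTranspose_mul, conjTranspose_mul, hρ.eq, conjTranspose_conjTranspose,
      Matrix.mul_assoc]
  have a1X := re_trace_of_resolvent_eq hρ hX X
  have a1Y := re_trace_of_resolvent_eq hρ hX Y
  simp only [conjTranspose_sub, Matrix.sub_mul, Matrix.mul_sub, trace_sub, Complex.sub_re]
  rw [c1, c2]
  linear_combination -a1X + 2 * a1Y - a2 + 2 * hlin

/-- The Hermitian matrix with eigenvectors the columns of `U` and eigenvalues `a`. -/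
noncomputable def ofSpectrum [DecidableEq m] (U : Matrix m m ℂ) (a : m → ℝ) : Matrix m m ℂ :=
  U * diagonal (fun i => (a i : ℂ)) * Uᴴ

lemma isHermitian_ofSpectrum [DecidableEq m] (U : Matrix m m ℂ) (a : m → ℝ) :
    (ofSpectrum U a).IsHermitian := by
  have h : star (fun i => (a i : ℂ)) = fun i => (a i : ℂ) := by
    ext i
    simp
  simp [ofSpectrum, IsHermitian, conjTranspose_mul, diagonal_conjTranspose, Matrix.mul_assoc, h]

lemma ofSpectrum_mul_ofSpectrum [DecidableEq m] {U : Matrix m m ℂ} (hU : Uᴴ * U = 1)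
    (a b : m → ℝ) : ofSpectrum U a * ofSpectrum U b = ofSpectrum U fun i => a i * b i := by
  have : ofSpectrum U a * ofSpectrum U b = U * (diagonal (fun i => (a i : ℂ)) * (Uᴴ * U) *
      diagonal (fun i => (b i : ℂ))) * Uᴴ := by
    simp only [ofSpectrum, Matrix.mul_assoc]
  rw [this, hU, Matrix.mul_one, diagonal_mul_diagonal, ofSpectrum]
  simp

lemma mul_sq_mul_conjTranspose {l : Type*} [Fintype l] {S : Matrix m m ℂ}
    (hS : S.IsHermitian) (M : Matrix l m ℂ) :
    M * (S * S) * Mᴴ = (S * Mᴴ)ᴴ * (S * Mᴴ) := by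
  rw [conjTranspose_mul, hS.eq, conjTranspose_conjTranspose]
  simp only [Matrix.mul_assoc]

/-- Spectral decompositions of a pair of positive semidefinite matrices, the kernel of the
second being contained in the kernel of the first. -/
structure SpectralPair (m : Type*) [Fintype m] [DecidableEq m] where
  /-- eigenvectors of the first matrix -/
  U : Matrix m m ℂ
  /-- eigenvectors of the second matrix -/
  V : Matrix m m ℂ
  /-- eigenvalues of the first matrix -/
  p : m → ℝ
  /-- eigenvalues of the second matrix -/
  q : m → ℝ
  hU : Uᴴ * U = 1
  hV : Vᴴ * V = 1
  hp : ∀ i, 0 ≤ p i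
  hq : ∀ j, 0 ≤ q j
  supp : ∀ j i, q j = 0 → p i ≠ 0 → (Vᴴ * U) j i = 0

namespace SpectralPair

variable [DecidableEq m] [DecidableEq n] (D : SpectralPair m) (D' : SpectralPair n)

/-- The first matrix of the pair. -/
noncomputable def ρ : Matrix m m ℂ := ofSpectrum D.U D.p

/-- The second matrix of the pair. -/
noncomputable def σ : Matrix m m ℂ := ofSpectrum D.V D.q

/-- The square root of the second matrix. -/
noncomputable def sqrtσ : Matrix m m ℂ := ofSpectrum D.V fun j => √(D.q j)

/-- The square root of the pseudo-inverse of the second matrix. -/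
noncomputable def invSqrtσ : Matrix m m ℂ := ofSpectrum D.V fun j => (√(D.q j))⁻¹

/-- The square root of the first matrix. -/
noncomputable def sqrtρ : Matrix m m ℂ := ofSpectrum D.U fun i => √(D.p i)

/-- The function `g` of the commuting operations of multiplying by `σ` on the left and by `ρ` on
the right, applied to the identity. -/
noncomputable def relMul (g : ℝ → ℝ → ℝ) : Matrix m m ℂ :=
  D.V * (of fun j i => (g (D.q j) (D.p i) : ℂ) * (D.Vᴴ * D.U) j i) * D.Uᴴ

/-- The overlap of the `j`-th eigenvector of `σ` with the `i`-th eigenvector of `ρ`. -/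
noncomputable def overlap (j i : m) : ℝ := Complex.normSq ((D.Vᴴ * D.U) j i)

lemma U_mul : D.U * D.Uᴴ = 1 := mul_eq_one_comm.1 D.hU

lemma V_mul : D.V * D.Vᴴ = 1 := mul_eq_one_comm.1 D.hV

lemma relMul_congr {g g' : ℝ → ℝ → ℝ}
    (h : ∀ j i, (D.q j = 0 → D.p i = 0) → g (D.q j) (D.p i) = g' (D.q j) (D.p i)) :
    D.relMul g = D.relMul g' := by
  unfold relMul
  congr 2
  ext j i
  simp only [of_apply]
  by_cases hw : D.q j = 0 ∧ D.p i ≠ 0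
  · rw [D.supp j i hw.1 hw.2, mul_zero, mul_zero]
  · rw [h j i (by tauto)]

lemma ofSpectrum_mul_relMul (a : ℝ → ℝ) (g : ℝ → ℝ → ℝ) :
    ofSpectrum D.V (fun j => a (D.q j)) * D.relMul g = D.relMul fun q p => a q * g q p := by
  have : ofSpectrum D.V (fun j => a (D.q j)) * D.relMul g =
      D.V * (diagonal (fun j => (a (D.q j) : ℂ)) * ((D.Vᴴ * D.V) *
        (of fun j i => (g (D.q j) (D.p i) : ℂ) * (D.Vᴴ * D.U) j i))) * D.Uᴴ := by
    simp only [ofSpectrum, relMul, Matrix.mul_assoc]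
  rw [this, D.hV, Matrix.one_mul, relMul]
  congr 2
  ext j i
  simp [mul_assoc]

lemma relMul_mul_ofSpectrum (b : ℝ → ℝ) (g : ℝ → ℝ → ℝ) :
    D.relMul g * ofSpectrum D.U (fun i => b (D.p i)) = D.relMul fun q p => g q p * b p := by
  have : D.relMul g * ofSpectrum D.U (fun i => b (D.p i)) =
      D.V * ((of fun j i => (g (D.q j) (D.p i) : ℂ) * (D.Vᴴ * D.U) j i) * (D.Uᴴ * D.U) *
        diagonal (fun i => (b (D.p i) : ℂ))) * D.Uᴴ := by
    simp only [ofSpectrum, relMul, Matrix.mul_assoc]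
  rw [this, D.hU, Matrix.mul_one, relMul]
  congr 2
  ext j i
  simp only [mul_diagonal, of_apply, Complex.ofReal_mul]
  ring

lemma relMul_one : D.relMul (fun _ _ => 1) = 1 := by
  have : D.relMul (fun _ _ => 1) = (D.V * D.Vᴴ) * (D.U * D.Uᴴ) := by
    simp only [relMul, Complex.ofReal_one, one_mul, Matrix.mul_assoc]
    rw [← Matrix.mul_assoc D.Vᴴ]
    rfl
  rw [this, D.U_mul, D.V_mul, Matrix.one_mul]

lemma relMul_snd (b : ℝ → ℝ) :
    D.relMul (fun _ p => b p) = ofSpectrum D.U (fun i => b (D.p i)) := by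
  rw [← Matrix.one_mul (ofSpectrum _ _), ← D.relMul_one, relMul_mul_ofSpectrum]
  simp

lemma relMul_sum {ι : Type*} (s : Finset ι) (c : ι → ℝ) (g : ι → ℝ → ℝ → ℝ) :
    ∑ l ∈ s, (c l : ℂ) • D.relMul (g l) = D.relMul fun q p => ∑ l ∈ s, c l * g l q p := by
  have h : ∀ (x : ℂ) (M : Matrix m m ℂ), x • (D.V * M * D.Uᴴ) = D.V * (x • M) * D.Uᴴ := by
    simp
  simp only [relMul, h]
  rw [← Finset.sum_mul, ← Finset.mul_sum]
  congr 2
  ext j i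
  simp [Matrix.sum_apply, Finset.sum_mul, mul_assoc]

lemma trace_relMul (g : ℝ → ℝ → ℝ) :
    (D.relMul g).trace.re = ∑ j, ∑ i, g (D.q j) (D.p i) * D.overlap j i := by
  rw [relMul, trace_mul_comm, ← Matrix.mul_assoc, trace_mul_comm,
    trace, Complex.re_sum]
  refine Finset.sum_congr rfl fun j _ => ?_
  rw [diag_apply, Matrix.mul_apply, Complex.re_sum]
  refine Finset.sum_congr rfl fun i _ => ?_
  have : (D.Uᴴ * D.V) i j = star ((D.Vᴴ * D.U) j i) := by
    rw [← conjTranspose_apply, conjTranspose_mul, conjTranspose_conjTranspose]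
  rw [this, of_apply, mul_assoc, Complex.star_def, Complex.mul_conj, ← Complex.ofReal_mul,
    Complex.ofReal_re, overlap]

lemma sum_overlap (i : m) : ∑ j, D.overlap j i = 1 := by
  have h : (D.Vᴴ * D.U)ᴴ * (D.Vᴴ * D.U) = 1 := by
    rw [conjTranspose_mul, conjTranspose_conjTranspose, Matrix.mul_assoc, ← Matrix.mul_assoc D.V,
      D.V_mul, Matrix.one_mul, D.hU]
  have h2 := congrFun (congrFun h i) i
  rw [Matrix.mul_apply, one_apply_eq] at h2
  simp only [conjTranspose_apply, Complex.star_def, ← Complex.normSq_eq_conj_mul_self] at h2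
  exact_mod_cast h2

/-- The solution `X` of `σ X + t X ρ = ρ`. -/
noncomputable def resolvent (t : ℝ) : Matrix m m ℂ := D.relMul fun q p => p / (q + t * p)

lemma resolvent_spec {t : ℝ} (ht : 0 ≤ t) :
    D.σ * D.resolvent t + (t : ℂ) • (D.resolvent t * D.ρ) = D.ρ := by
  have h := D.relMul_sum Finset.univ ![1, t]
    ![fun q p => q * (p / (q + t * p)), fun q p => p / (q + t * p) * p]
  simp only [Fin.sum_univ_two, cons_val_zero, cons_val_one, Complex.ofReal_one, one_smul,
    one_mul] at h
  rw [σ, ρ, resolvent, D.ofSpectrum_mul_relMul (fun x => x), D.relMul_mul_ofSpectrum (fun x => x),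
    h, ← D.relMul_snd (fun x => x)]
  refine D.relMul_congr fun j i h0 => ?_
  have hq := D.hq j
  have hp := D.hp i
  by_cases hq0 : D.q j = 0
  · simp [hq0, h0 hq0]
  · have : D.q j + t * D.p i ≠ 0 := by positivity
    field_simp

lemma trace_resolvent_mul (t : ℝ) : (D.resolvent t * D.ρ).trace.re =
    ∑ j, ∑ i, D.p i * D.overlap j i * (D.p i / (D.q j + t * D.p i)) := by
  rw [resolvent, ρ, D.relMul_mul_ofSpectrum (fun x => x), trace_relMul]
  refine Finset.sum_congr rfl fun j _ => Finset.sum_congr rfl fun i _ => by ring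

lemma trace_rho : D.ρ.trace.re = ∑ i, D.p i := by
  rw [ρ, ← D.relMul_snd (fun x => x), trace_relMul, Finset.sum_comm]
  simp_rw [← Finset.mul_sum, sum_overlap, mul_one]

/-- The relative entropy `D(ρ‖σ)`. -/
noncomputable def relEnt : ℝ :=
  ∑ j, ∑ i, D.p i * D.overlap j i * (Real.log (D.p i) - Real.log (D.q j))

/-- A primitive of `t ↦ tr (ρ X)`, where `σ X + t X ρ = ρ`. -/
noncomputable def logPotential (t : ℝ) : ℝ :=
  ∑ j, ∑ i, D.p i * D.overlap j i * Real.log (D.q j + t * D.p i)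

lemma weight_cases (j i : m) : D.p i * D.overlap j i = 0 ∨ (0 < D.p i ∧ 0 < D.q j) := by
  by_cases hp : D.p i = 0
  · simp [hp]
  by_cases hq : D.q j = 0
  · left
    simp [overlap, D.supp j i hq hp]
  · exact Or.inr ⟨(D.hp i).lt_of_ne' hp, (D.hq j).lt_of_ne' hq⟩

lemma hasDerivAt_logPotential {t : ℝ} (ht : 0 ≤ t) :
    HasDerivAt D.logPotential (D.resolvent t * D.ρ).trace.re t := by
  rw [trace_resolvent_mul]
  refine HasDerivAt.fun_sum fun j _ => HasDerivAt.fun_sum fun i _ => ?_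
  rcases D.weight_cases j i with h | ⟨hp, hq⟩
  · simp only [h, zero_mul]
    exact hasDerivAt_const _ _
  · refine HasDerivAt.const_mul _ (HasDerivAt.log ?_ (by positivity))
    simpa using ((hasDerivAt_id t).mul_const (D.p i)).const_add (D.q j)

lemma tendsto_logPotential : Filter.Tendsto
    (fun t => D.logPotential t - D.logPotential 0 - (∑ i, D.p i) * Real.log t)
    Filter.atTop (nhds D.relEnt) := by
  have h : ∀ t, D.logPotential t - D.logPotential 0 - (∑ i, D.p i) * Real.log t =
      ∑ j, ∑ i, D.p i * D.overlap j i *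
        (Real.log (D.q j + t * D.p i) - Real.log (D.q j) - Real.log t) := by
    intro t
    have : ∑ i, D.p i = ∑ j, ∑ i, D.p i * D.overlap j i := by
      rw [Finset.sum_comm]
      simp_rw [← Finset.mul_sum, sum_overlap, mul_one]
    simp only [logPotential, this, Finset.sum_mul, ← Finset.sum_sub_distrib]
    refine Finset.sum_congr rfl fun j _ => Finset.sum_congr rfl fun i _ => ?_
    rw [zero_mul, add_zero]
    ring
  simp_rw [h]
  refine tendsto_finsetSum _ fun j _ => tendsto_finsetSum _ fun i _ => ?_
  rcases D.weight_cases j i with h | ⟨hp, hq⟩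
  · simp only [h, zero_mul]
    exact tendsto_const_nhds
  · refine Filter.Tendsto.const_mul _ ?_
    have h1 : Filter.Tendsto (fun t => Real.log (D.q j / t + D.p i)) Filter.atTop
        (nhds (Real.log (D.p i))) := by
      refine Filter.Tendsto.log ?_ hp.ne'
      simpa using (tendsto_const_nhds.div_atTop Filter.tendsto_id).add_const (D.p i)
    refine (h1.sub_const (Real.log (D.q j))).congr' ?_
    filter_upwards [Filter.eventually_gt_atTop 0] with t ht
    have : D.q j / t + D.p i = (D.q j + t * D.p i) / t := by field_simp
    rw [this, Real.log_div (by positivity) ht.ne']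
    ring

lemma sqrtσ_mul_self : D.sqrtσ * D.sqrtσ = D.σ := by
  simp_rw [sqrtσ, ofSpectrum_mul_ofSpectrum D.hV, Real.mul_self_sqrt (D.hq _), σ]

lemma sqrtρ_mul_self : D.sqrtρ * D.sqrtρ = D.ρ := by
  simp_rw [sqrtρ, ofSpectrum_mul_ofSpectrum D.hU, Real.mul_self_sqrt (D.hp _), ρ]

/-- The square root of the relative modular operator, applied to the identity. -/
noncomputable def sqrtRel : Matrix m m ℂ := D.relMul fun q p => √(p / q)

lemma sqrtσ_mul_sqrtRel : D.sqrtσ * D.sqrtRel = D.sqrtρ := by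
  rw [sqrtσ, sqrtRel, sqrtρ, D.ofSpectrum_mul_relMul (fun x => √x),
    ← D.relMul_snd (fun x => √x)]
  refine D.relMul_congr fun j i h0 => ?_
  by_cases hq0 : D.q j = 0
  · simp [hq0, h0 hq0]
  · rw [← Real.sqrt_mul (D.hq j), mul_div_cancel₀ _ hq0]

lemma invSqrtσ_mul_sqrtρ : D.invSqrtσ * D.sqrtρ = D.sqrtRel := by
  rw [invSqrtσ, sqrtRel, sqrtρ, ← D.relMul_snd (fun x => √x),
    D.ofSpectrum_mul_relMul (fun x => (√x)⁻¹)]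
  refine D.relMul_congr fun j i _ => ?_
  rw [Real.sqrt_div (D.hp i), div_eq_inv_mul]

lemma invSqrtσ_mul_sqrtσ_mul_rho : D.invSqrtσ * D.sqrtσ * D.ρ = D.ρ := by
  rw [← sqrtρ_mul_self, ← Matrix.mul_assoc, Matrix.mul_assoc D.invSqrtσ, ← sqrtσ_mul_sqrtRel,
    ← Matrix.mul_assoc D.sqrtσ, sqrtσ_mul_self, invSqrtσ, σ, sqrtRel,
    D.ofSpectrum_mul_relMul (fun x => x), D.ofSpectrum_mul_relMul (fun x => (√x)⁻¹), sqrtσ,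
    D.ofSpectrum_mul_relMul (fun x => √x)]
  congr 1
  refine D.relMul_congr fun j i _ => ?_
  by_cases hq0 : D.q j = 0
  · simp [hq0]
  · have : √(D.q j) ≠ 0 := (Real.sqrt_pos.2 ((D.hq j).lt_of_ne' hq0)).ne'
    field_simp
    rw [Real.sq_sqrt (D.hq j)]

variable {D D'}

lemma trace_resolvent_channel {L : κ → Matrix n m ℂ} (hL : ∑ k, (L k)ᴴ * L k = 1)
    (hρ : D'.ρ = ∑ k, L k * D.ρ * (L k)ᴴ) (hσ : D'.σ = ∑ k, L k * D.σ * (L k)ᴴ)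
    {t : ℝ} (ht : 0 ≤ t) :
    (D'.resolvent t * D'.ρ).trace.re ≤ (D.resolvent t * D.ρ).trace.re ∧
    ((D'.resolvent t * D'.ρ).trace.re = (D.resolvent t * D.ρ).trace.re →
      ∀ k, (D'.resolvent t)ᴴ * L k * D.sqrtσ = L k * (D.resolvent t)ᴴ * D.sqrtσ) := by
  have hS : D.sqrtσ.IsHermitian := isHermitian_ofSpectrum _ _
  have hP : D.sqrtρ.IsHermitian := isHermitian_ofSpectrum _ _
  have hX := D.resolvent_spec ht
  have hX' := D'.resolvent_spec ht
  generalize D.resolvent t = X at *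
  generalize D'.resolvent t = X' at *
  obtain ⟨Y, hY⟩ : ∃ Y, Y = ∑ k, (L k)ᴴ * X' * L k := ⟨_, rfl⟩
  have key := trace_resolvent_sub (ρ := D.ρ) (σ := D.σ) (ρ' := D'.ρ) L hL t
    (isHermitian_ofSpectrum _ _) (isHermitian_ofSpectrum _ _)
    (isHermitian_ofSpectrum _ _) hρ hσ hX hX' Y hY
  have e1 : (Y - X)ᴴ * D.σ * (Y - X) = (D.sqrtσ * (Y - X))ᴴ * (D.sqrtσ * (Y - X)) := by
    rw [← sqrtσ_mul_self]
    simpa using mul_sq_mul_conjTranspose hS (Y - X)ᴴ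
  have e2 : (Y - X) * D.ρ * (Y - X)ᴴ = (D.sqrtρ * (Y - X)ᴴ)ᴴ * (D.sqrtρ * (Y - X)ᴴ) := by
    rw [← sqrtρ_mul_self, mul_sq_mul_conjTranspose hP]
  have e3 : ∀ M : Matrix n m ℂ, M * D.σ * Mᴴ = (D.sqrtσ * Mᴴ)ᴴ * (D.sqrtσ * Mᴴ) := fun M => by
    rw [← sqrtσ_mul_self, mul_sq_mul_conjTranspose hS]
  have e4 : ∀ M : Matrix n m ℂ, M * D.ρ * Mᴴ = (D.sqrtρ * Mᴴ)ᴴ * (D.sqrtρ * Mᴴ) := fun M => by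
    rw [← sqrtρ_mul_self, mul_sq_mul_conjTranspose hP]
  simp only [e1, e2, e3, e4] at key
  have n1 := re_trace_conjTranspose_mul_self_nonneg (D.sqrtσ * (Y - X))
  have n2 := mul_nonneg ht (re_trace_conjTranspose_mul_self_nonneg (D.sqrtρ * (Y - X)ᴴ))
  have n3 := fun k (_ : k ∈ Finset.univ) =>
    re_trace_conjTranspose_mul_self_nonneg (D.sqrtσ * (X'ᴴ * L k - L k * Yᴴ)ᴴ)
  have n4 := mul_nonneg ht (Finset.sum_nonneg fun k (_ : k ∈ Finset.univ) =>
    re_trace_conjTranspose_mul_self_nonneg (D.sqrtρ * (X' * L k - L k * Y)ᴴ))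
  have n3' := Finset.sum_nonneg n3
  refine ⟨by linarith, fun heq k => ?_⟩
  have z1 := eq_zero_of_re_trace_conjTranspose_mul_self (M := D.sqrtσ * (Y - X)) (by linarith)
  have z3 := (Finset.sum_eq_zero_iff_of_nonneg n3).1 (by linarith) k (Finset.mem_univ k)
  replace z3 := congrArg conjTranspose (eq_zero_of_re_trace_conjTranspose_mul_self z3)
  replace z1 := congrArg conjTranspose z1
  simp only [conjTranspose_mul, conjTranspose_conjTranspose, hS.eq, conjTranspose_zero,
    conjTranspose_sub, Matrix.sub_mul, sub_eq_zero] at z1 z3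
  rw [z3, Matrix.mul_assoc, z1, Matrix.mul_assoc]

lemma sqrtRel_channel {K : Matrix n m ℂ}
    (h : ∀ t, 0 < t → (D'.resolvent t)ᴴ * K * D.sqrtσ = K * (D.resolvent t)ᴴ * D.sqrtσ) :
    D'.sqrtRelᴴ * K * D.sqrtσ = K * D.sqrtRelᴴ * D.sqrtσ := by
  classical
  obtain ⟨T, c, hT, hc⟩ := exists_sum_resolvent_eq_sqrt
    ((Finset.univ.image fun x : m × m => D.p x.2 / D.q x.1) ∪
      Finset.univ.image fun x : n × n => D'.p x.2 / D'.q x.1) (by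
    intro r hr
    simp only [Finset.mem_union, Finset.mem_image] at hr
    rcases hr with ⟨x, -, rfl⟩ | ⟨x, -, rfl⟩
    · exact div_nonneg (D.hp _) (D.hq _)
    · exact div_nonneg (D'.hp _) (D'.hq _))
  have scalar : ∀ t q p : ℝ, (q = 0 → p = 0) → p / (q + t * p) = p / q / (1 + t * (p / q)) := by
    intro t q p h0
    by_cases hq0 : q = 0
    · simp [hq0, h0 hq0]
    · rw [div_div, mul_add, mul_one, mul_left_comm, mul_div_cancel₀ _ hq0]
  have e : ∑ t ∈ T, (c t : ℂ) • D.resolvent t = D.sqrtRel := by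
    simp only [resolvent, D.relMul_sum, sqrtRel]
    refine D.relMul_congr fun j i h0 => ?_
    rw [← hc _ (Finset.mem_union_left _ (Finset.mem_image_of_mem _ (Finset.mem_univ (j, i))))]
    exact Finset.sum_congr rfl fun t _ => by rw [scalar _ _ _ h0]
  have e' : ∑ t ∈ T, (c t : ℂ) • D'.resolvent t = D'.sqrtRel := by
    simp only [resolvent, D'.relMul_sum, sqrtRel]
    refine D'.relMul_congr fun j i h0 => ?_
    rw [← hc _ (Finset.mem_union_right _ (Finset.mem_image_of_mem _ (Finset.mem_univ (j, i))))]
    exact Finset.sum_congr rfl fun t _ => by rw [scalar _ _ _ h0]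
  simp only [← e, ← e', conjTranspose_sum, conjTranspose_smul, Matrix.sum_mul, Matrix.mul_sum,
    Matrix.smul_mul, Matrix.mul_smul]
  exact Finset.sum_congr rfl fun t ht => by rw [h t (hT t ht)]

/-- Monotonicity of relative entropy, and recovery by the Petz map in the case of equality. -/
theorem relEnt_channel {L : κ → Matrix n m ℂ} (hL : ∑ k, (L k)ᴴ * L k = 1)
    (hρ : D'.ρ = ∑ k, L k * D.ρ * (L k)ᴴ) (hσ : D'.σ = ∑ k, L k * D.σ * (L k)ᴴ) :
    D'.relEnt ≤ D.relEnt ∧ (D'.relEnt = D.relEnt →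
      ∑ k, D.sqrtσ * (L k)ᴴ * D'.invSqrtσ * D'.ρ * (D'.invSqrtσ * L k * D.sqrtσ) = D.ρ) := by
  have htr : ∑ i, D'.p i = ∑ i, D.p i := by
    rw [← trace_rho, ← trace_rho, hρ, trace_sum,
      Finset.sum_congr rfl fun k _ => (trace_mul_comm (L k * D.ρ) (L k)ᴴ), ← trace_sum]
    simp_rw [← Matrix.mul_assoc]
    rw [← Finset.sum_mul, hL, Matrix.one_mul]
  obtain ⟨hle, heq⟩ := le_limit_of_deriv_nonneg
    (h := fun t => D.logPotential t - D.logPotential 0 -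
      (D'.logPotential t - D'.logPotential 0))
    (h' := fun t => (D.resolvent t * D.ρ).trace.re - (D'.resolvent t * D'.ρ).trace.re)
    (l := D.relEnt - D'.relEnt)
    (fun t ht => ((D.hasDerivAt_logPotential ht).sub_const _).sub
      ((D'.hasDerivAt_logPotential ht).sub_const _))
    (fun t ht => sub_nonneg.2 (trace_resolvent_channel hL hρ hσ ht).1)
    ((D.tendsto_logPotential.sub D'.tendsto_logPotential).congr fun t => by rw [htr]; ring)
  simp only [sub_self] at hle heq
  refine ⟨sub_nonneg.1 hle, fun h => ?_⟩
  have hZ : ∀ k, D'.sqrtRelᴴ * L k * D.sqrtσ = L k * D.sqrtRelᴴ * D.sqrtσ := fun k =>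
    sqrtRel_channel fun t ht => (trace_resolvent_channel hL hρ hσ ht.le).2
      (sub_eq_zero.1 (heq (by rw [h, sub_self]) t ht)).symm k
  have hS : D.sqrtσ.IsHermitian := isHermitian_ofSpectrum _ _
  have hT : D'.invSqrtσ.IsHermitian := isHermitian_ofSpectrum _ _
  have hP : D.sqrtρ.IsHermitian := isHermitian_ofSpectrum _ _
  have hP' : D'.sqrtρ.IsHermitian := isHermitian_ofSpectrum _ _
  have term : ∀ k, D.sqrtσ * (L k)ᴴ * D'.invSqrtσ * D'.ρ * (D'.invSqrtσ * L k * D.sqrtσ) =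
      D.sqrtρ * ((L k)ᴴ * L k) * D.sqrtρ := by
    intro k
    have h1 : D'.sqrtρ * D'.invSqrtσ * L k * D.sqrtσ = L k * D.sqrtρ := by
      have := hZ k
      rwa [← invSqrtσ_mul_sqrtρ, conjTranspose_mul, hT.eq, hP'.eq, Matrix.mul_assoc (L k),
        ← hS.eq, ← conjTranspose_mul, hS.eq, sqrtσ_mul_sqrtRel, hP.eq] at this
    have h2 := congrArg conjTranspose h1
    simp only [conjTranspose_mul, hS.eq, hT.eq, hP.eq, hP'.eq] at h2
    calc _ = (D.sqrtσ * ((L k)ᴴ * (D'.invSqrtσ * D'.sqrtρ))) *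
          (D'.sqrtρ * D'.invSqrtσ * L k * D.sqrtσ) := by
          rw [← sqrtρ_mul_self]
          simp only [Matrix.mul_assoc]
      _ = _ := by
          rw [h1, h2]
          simp only [Matrix.mul_assoc]
  rw [Finset.sum_congr rfl fun k _ => term k, ← Finset.sum_mul, ← Finset.mul_sum, hL,
    Matrix.mul_one, sqrtρ_mul_self]

end SpectralPair

section Bipartite

open scoped Kronecker

variable {A B B' ι : Type*} [Fintype A] [Fintype B] [Fintype B'] [Fintype ι]

lemma isCPTP_of_kraus [DecidableEq B] (K : ι → Matrix B' B ℂ) (hK : ∑ k, (K k)ᴴ * K k = 1) :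
    IsCPTP fun X : Matrix B B ℂ => ∑ k, K k * X * (K k)ᴴ := by
  let e := (Fintype.equivFin ι).symm
  refine ⟨Fintype.card ι, fun k => K (e k), fun X => ?_, ?_⟩
  · exact (e.sum_comp fun k => K k * X * (K k)ᴴ).symm
  · rw [← hK]
    exact e.sum_comp fun k => (K k)ᴴ * K k

lemma extA_kraus [DecidableEq A] (K : ι → Matrix B' B ℂ) (X : Matrix (A × B) (A × B) ℂ) :
    extA (fun Y : Matrix B B ℂ => ∑ k, K k * Y * (K k)ᴴ) X =
      ∑ k, ((1 : Matrix A A ℂ) ⊗ₖ K k) * X * ((1 : Matrix A A ℂ) ⊗ₖ K k)ᴴ := by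
  ext ⟨i, b⟩ ⟨j, c⟩
  simp only [extA, of_apply, Matrix.sum_apply]
  refine Finset.sum_congr rfl fun k _ => ?_
  simp [Matrix.mul_apply, Fintype.sum_prod_type, one_apply, kroneckerMap_apply,
    Finset.sum_ite_irrel, apply_ite (starRingEnd ℂ)]

lemma ptraceB_extA_kraus [DecidableEq B] (K : ι → Matrix B' B ℂ) (hK : ∑ k, (K k)ᴴ * K k = 1)
    (X : Matrix (A × B) (A × B) ℂ) :
    ptraceB (extA (fun Y : Matrix B B ℂ => ∑ k, K k * Y * (K k)ᴴ) X) = ptraceB X := by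
  have h : ∀ Y : Matrix B B ℂ, (∑ k, K k * Y * (K k)ᴴ).trace = Y.trace := by
    intro Y
    rw [trace_sum, Finset.sum_congr rfl fun k _ => (trace_mul_comm (K k * Y) (K k)ᴴ), ← trace_sum]
    simp_rw [← Matrix.mul_assoc]
    rw [← Finset.sum_mul, hK, Matrix.one_mul]
  ext i j
  exact h (of fun b c => X (i, b) (j, c))

lemma ptraceA_extA_kraus (K : ι → Matrix B' B ℂ) (X : Matrix (A × B) (A × B) ℂ) :
    ptraceA (extA (fun Y : Matrix B B ℂ => ∑ k, K k * Y * (K k)ᴴ) X) =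
      ∑ k, K k * ptraceA X * (K k)ᴴ := by
  have h : ptraceA X = ∑ i, of fun b c => X (i, b) (i, c) := by
    ext b c
    simp [ptraceA, Matrix.sum_apply]
  rw [h]
  simp only [Matrix.mul_sum, Matrix.sum_mul]
  rw [Finset.sum_comm]
  ext b c
  simp [ptraceA, extA, Matrix.sum_apply]

lemma ptraceB_kronecker_mul_mul [DecidableEq B] (X X' : Matrix A A ℂ) {Y Y' : Matrix B B ℂ}
    (hY : Y' * Y = 1) (M : Matrix (A × B) (A × B) ℂ) :
    ptraceB ((X ⊗ₖ Y) * M * (X' ⊗ₖ Y')) = X * ptraceB M * X' := by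
  ext i j
  have h : ∀ y x, ∑ b, Y' y b * Y b x = (1 : Matrix B B ℂ) y x := fun y x => by
    rw [← hY, Matrix.mul_apply]
  calc ptraceB ((X ⊗ₖ Y) * M * (X' ⊗ₖ Y')) i j
      = ∑ b, ∑ y, ∑ x, X i x.1 * X' y.1 j * M x y * (Y' y.2 b * Y b x.2) := by
        simp only [ptraceB, of_apply, Matrix.mul_apply, kroneckerMap_apply, Finset.sum_mul]
        refine Finset.sum_congr rfl fun b _ => Finset.sum_congr rfl fun y _ =>
          Finset.sum_congr rfl fun x _ => by ring
    _ = ∑ y, ∑ x, X i x.1 * X' y.1 j * M x y * (1 : Matrix B B ℂ) y.2 x.2 := by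
        rw [Finset.sum_comm]
        refine Finset.sum_congr rfl fun y _ => ?_
        rw [Finset.sum_comm]
        refine Finset.sum_congr rfl fun x _ => ?_
        rw [← Finset.mul_sum, h]
    _ = (X * ptraceB M * X') i j := by
        simp only [ptraceB, of_apply, Matrix.mul_apply, Fintype.sum_prod_type, one_apply,
          mul_ite, mul_one, mul_zero, Finset.sum_ite_eq, Finset.mem_univ, if_true,
          Finset.sum_mul, Finset.mul_sum]
        refine Finset.sum_congr rfl fun y _ => ?_
        rw [Finset.sum_comm]
        refine Finset.sum_congr rfl fun x _ => Finset.sum_congr rfl fun b _ => by ring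

lemma ptraceA_kronecker_mul_mul [DecidableEq A] {X X' : Matrix A A ℂ} (hX : X' * X = 1)
    (Y Y' : Matrix B B ℂ) (M : Matrix (A × B) (A × B) ℂ) :
    ptraceA ((X ⊗ₖ Y) * M * (X' ⊗ₖ Y')) = Y * ptraceA M * Y' := by
  have hswap : ∀ N : Matrix (A × B) (A × B) ℂ,
      ptraceA N = ptraceB (N.submatrix (Prod.swap : B × A → _) Prod.swap) := fun _ => rfl
  have hkron : ∀ (X : Matrix A A ℂ) (Y : Matrix B B ℂ),
      (X ⊗ₖ Y).submatrix (Prod.swap : B × A → _) Prod.swap = Y ⊗ₖ X := fun X Y => by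
    ext ⟨b, a⟩ ⟨c, d⟩
    simp [mul_comm]
  rw [hswap, hswap, ← ptraceB_kronecker_mul_mul Y Y' hX, ← hkron, ← hkron]
  congr 1
  have := (Equiv.prodComm B A).bijective
  rw [show (Prod.swap : B × A → A × B) = Equiv.prodComm B A from rfl, submatrix_mul_equiv,
    submatrix_mul_equiv]

lemma kronecker_finset_sum {l l' n n' : Type*} (X : Matrix l l' ℂ) (Y : ι → Matrix n n' ℂ) :
    X ⊗ₖ ∑ k, Y k = ∑ k, X ⊗ₖ Y k := by
  ext ⟨i, j⟩ ⟨i', j'⟩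
  simp [Matrix.sum_apply, Finset.mul_sum]

lemma posSemidef_ptraceB {M : Matrix (A × B) (A × B) ℂ} (hM : M.PosSemidef) :
    (ptraceB M).PosSemidef := by
  have : ptraceB M = ∑ b, M.submatrix (fun a => (a, b)) fun a => (a, b) := by
    ext i j
    simp [ptraceB, Matrix.sum_apply]
  rw [this]
  exact posSemidef_sum _ fun b _ => hM.submatrix _

lemma posSemidef_ptraceA {M : Matrix (A × B) (A × B) ℂ} (hM : M.PosSemidef) :
    (ptraceA M).PosSemidef := by
  have : ptraceA M = ∑ a, M.submatrix (fun b => (a, b)) fun b => (a, b) := by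
    ext i j
    simp [ptraceA, Matrix.sum_apply]
  rw [this]
  exact posSemidef_sum _ fun b _ => hM.submatrix _

lemma ofSpectrum_eigenvectorUnitary [DecidableEq m] {M : Matrix m m ℂ} (hM : M.IsHermitian) :
    ofSpectrum (hM.eigenvectorUnitary : Matrix m m ℂ) hM.eigenvalues = M := by
  conv_rhs => rw [hM.spectral_theorem, Unitary.conjStarAlgAut_apply]
  rfl

lemma conjTranspose_eigenvectorUnitary_mul_self [DecidableEq m] {M : Matrix m m ℂ}
    (hM : M.IsHermitian) :
    (hM.eigenvectorUnitary : Matrix m m ℂ)ᴴ * (hM.eigenvectorUnitary : Matrix m m ℂ) = 1 :=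
  Unitary.coe_star_mul_self _

lemma eigenvectorUnitary_mul_conjTranspose_self [DecidableEq m] {M : Matrix m m ℂ}
    (hM : M.IsHermitian) :
    (hM.eigenvectorUnitary : Matrix m m ℂ) * (hM.eigenvectorUnitary : Matrix m m ℂ)ᴴ = 1 :=
  Unitary.coe_mul_star_self _

lemma conjTranspose_mul_mul_eigenvectorUnitary [DecidableEq m] {N : Matrix m m ℂ}
    (hN : N.IsHermitian) (i : m) :
    (((hN.eigenvectorUnitary : Matrix m m ℂ)ᴴ * N * (hN.eigenvectorUnitary : Matrix m m ℂ)) i i).re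
      = hN.eigenvalues i := by
  have hU := conjTranspose_eigenvectorUnitary_mul_self hN
  have h : (hN.eigenvectorUnitary : Matrix m m ℂ)ᴴ * N * (hN.eigenvectorUnitary : Matrix m m ℂ) =
      diagonal fun i => (hN.eigenvalues i : ℂ) := by
    have h1 : (hN.eigenvectorUnitary : Matrix m m ℂ)ᴴ * N *
        (hN.eigenvectorUnitary : Matrix m m ℂ) = (hN.eigenvectorUnitary : Matrix m m ℂ)ᴴ *
          ofSpectrum (hN.eigenvectorUnitary : Matrix m m ℂ) hN.eigenvalues *
            (hN.eigenvectorUnitary : Matrix m m ℂ) := by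
      rw [ofSpectrum_eigenvectorUnitary hN]
    rw [h1, ofSpectrum, ← Matrix.mul_assoc, ← Matrix.mul_assoc, hU, Matrix.one_mul,
      Matrix.mul_assoc, hU, Matrix.mul_one]
  rw [h, diagonal_apply_eq, Complex.ofReal_re]

lemma ofSpectrum_kronecker [DecidableEq A] [DecidableEq B] (U : Matrix A A ℂ) (V : Matrix B B ℂ)
    (a : A → ℝ) (b : B → ℝ) :
    ofSpectrum (U ⊗ₖ V) (fun x => a x.1 * b x.2) = ofSpectrum U a ⊗ₖ ofSpectrum V b := by
  simp only [ofSpectrum, conjTranspose_kronecker, mul_kronecker_mul,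
    diagonal_kronecker_diagonal, Complex.ofReal_mul]

lemma sum_mul_normSq [DecidableEq m] (U V : Matrix m m ℂ) (p : m → ℝ) (j : m) :
    ∑ i, p i * Complex.normSq ((Vᴴ * U) j i) = ((Vᴴ * ofSpectrum U p * V) j j).re := by
  have : Vᴴ * ofSpectrum U p * V = (Vᴴ * U) * diagonal (fun i => (p i : ℂ)) * (Vᴴ * U)ᴴ := by
    simp [ofSpectrum, Matrix.mul_assoc]
  rw [this, Matrix.mul_apply, Complex.re_sum]
  refine Finset.sum_congr rfl fun i _ => ?_
  rw [mul_diagonal, conjTranspose_apply, Complex.star_def, mul_right_comm, Complex.mul_conj,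
    ← Complex.ofReal_mul, Complex.ofReal_re, mul_comm]

lemma posSemidef_extA [DecidableEq A] [DecidableEq B] {M : Matrix (A × B) (A × B) ℂ}
    (hM : M.PosSemidef)
    {Φ : Matrix B B ℂ → Matrix B' B' ℂ} (hΦ : IsCPTP Φ) : (extA (A := A) Φ M).PosSemidef := by
  obtain ⟨κ, K, hΦK, -⟩ := hΦ
  rw [funext hΦK, extA_kraus]
  exact posSemidef_sum _ fun k _ => hM.mul_mul_conjTranspose_same _

variable [DecidableEq A] [DecidableEq B] [DecidableEq B']

/-- The joint distribution of a bipartite state measured in the product of the eigenbases of its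
marginals. -/
noncomputable def marginalWeight {M : Matrix (A × B) (A × B) ℂ} (hM : M.PosSemidef) (x : A × B) :
    ℝ :=
  ∑ i, hM.1.eigenvalues i * Complex.normSq
    (((((posSemidef_ptraceB hM).1.eigenvectorUnitary : Matrix A A ℂ) ⊗ₖ
      ((posSemidef_ptraceA hM).1.eigenvectorUnitary : Matrix B B ℂ))ᴴ *
        (hM.1.eigenvectorUnitary : Matrix (A × B) (A × B) ℂ)) x i)

section

variable {M : Matrix (A × B) (A × B) ℂ} (hM : M.PosSemidef)

lemma marginalWeight_term_nonneg (x i : A × B) : 0 ≤ hM.1.eigenvalues i * Complex.normSq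
    (((((posSemidef_ptraceB hM).1.eigenvectorUnitary : Matrix A A ℂ) ⊗ₖ
      ((posSemidef_ptraceA hM).1.eigenvectorUnitary : Matrix B B ℂ))ᴴ *
        (hM.1.eigenvectorUnitary : Matrix (A × B) (A × B) ℂ)) x i) :=
  mul_nonneg (hM.eigenvalues_nonneg i) (Complex.normSq_nonneg _)

lemma marginalWeight_nonneg (x : A × B) : 0 ≤ marginalWeight hM x :=
  Finset.sum_nonneg fun i _ => marginalWeight_term_nonneg hM x i

lemma sum_marginalWeight_right (a : A) :
    ∑ b, marginalWeight hM (a, b) = (posSemidef_ptraceB hM).1.eigenvalues a := by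
  simp_rw [marginalWeight, sum_mul_normSq, ofSpectrum_eigenvectorUnitary]
  rw [← Complex.re_sum,
    ← conjTranspose_mul_mul_eigenvectorUnitary,
    ← ptraceB_kronecker_mul_mul _ _ (eigenvectorUnitary_mul_conjTranspose_self
      (posSemidef_ptraceA hM).1), conjTranspose_kronecker]
  rfl

lemma sum_marginalWeight_left (b : B) :
    ∑ a, marginalWeight hM (a, b) = (posSemidef_ptraceA hM).1.eigenvalues b := by
  simp_rw [marginalWeight, sum_mul_normSq, ofSpectrum_eigenvectorUnitary]
  rw [← Complex.re_sum,
    ← conjTranspose_mul_mul_eigenvectorUnitary,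
    ← ptraceA_kronecker_mul_mul (eigenvectorUnitary_mul_conjTranspose_self
      (posSemidef_ptraceB hM).1), conjTranspose_kronecker]
  rfl

lemma marginalWeight_eq_zero (x : A × B) (hx : (posSemidef_ptraceB hM).1.eigenvalues x.1 *
    (posSemidef_ptraceA hM).1.eigenvalues x.2 = 0) : marginalWeight hM x = 0 := by
  rcases mul_eq_zero.1 hx with h | h
  · rw [← sum_marginalWeight_right hM] at h
    exact (Finset.sum_eq_zero_iff_of_nonneg fun b _ => marginalWeight_nonneg hM _).1 h x.2
      (Finset.mem_univ _)
  · rw [← sum_marginalWeight_left hM] at h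
    exact (Finset.sum_eq_zero_iff_of_nonneg fun b _ => marginalWeight_nonneg hM _).1 h x.1
      (Finset.mem_univ _)

/-- A bipartite state paired with the product of its marginals. -/
noncomputable def marginalPair : SpectralPair (A × B) where
  U := hM.1.eigenvectorUnitary
  V := ((posSemidef_ptraceB hM).1.eigenvectorUnitary : Matrix A A ℂ) ⊗ₖ
    ((posSemidef_ptraceA hM).1.eigenvectorUnitary : Matrix B B ℂ)
  p := hM.1.eigenvalues
  q x := (posSemidef_ptraceB hM).1.eigenvalues x.1 * (posSemidef_ptraceA hM).1.eigenvalues x.2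
  hU := Unitary.coe_star_mul_self _
  hV := by
    rw [conjTranspose_kronecker, ← mul_kronecker_mul, ← one_kronecker_one]
    congr 1
    · exact Unitary.coe_star_mul_self _
    · exact Unitary.coe_star_mul_self _
  hp := hM.eigenvalues_nonneg
  hq x := mul_nonneg ((posSemidef_ptraceB hM).eigenvalues_nonneg _)
    ((posSemidef_ptraceA hM).eigenvalues_nonneg _)
  supp x i hx hi := by
    have := (Finset.sum_eq_zero_iff_of_nonneg fun i _ => marginalWeight_term_nonneg hM x i).1
      (marginalWeight_eq_zero hM x hx) i (Finset.mem_univ i)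
    exact Complex.normSq_eq_zero.1 ((mul_eq_zero.1 this).resolve_left hi)

lemma marginalPair_ρ : (marginalPair hM).ρ = M := ofSpectrum_eigenvectorUnitary hM.1

lemma marginalPair_σ : (marginalPair hM).σ = ptraceB M ⊗ₖ ptraceA M := by
  rw [SpectralPair.σ]
  refine (ofSpectrum_kronecker _ _ _ _).trans ?_
  rw [ofSpectrum_eigenvectorUnitary, ofSpectrum_eigenvectorUnitary]

/-- The square root of a positive semidefinite matrix. -/
noncomputable def sqrtPSD [DecidableEq m] {N : Matrix m m ℂ} (hN : N.PosSemidef) :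
    Matrix m m ℂ :=
  ofSpectrum (hN.1.eigenvectorUnitary : Matrix m m ℂ) fun i => √(hN.1.eigenvalues i)

/-- The square root of the pseudo-inverse of a positive semidefinite matrix. -/
noncomputable def invSqrtPSD [DecidableEq m] {N : Matrix m m ℂ} (hN : N.PosSemidef) :
    Matrix m m ℂ :=
  ofSpectrum (hN.1.eigenvectorUnitary : Matrix m m ℂ) fun i => (√(hN.1.eigenvalues i))⁻¹

/-- The orthogonal projection onto the range of a positive semidefinite matrix. -/
noncomputable def suppProj [DecidableEq m] {N : Matrix m m ℂ} (hN : N.PosSemidef) :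
    Matrix m m ℂ :=
  ofSpectrum (hN.1.eigenvectorUnitary : Matrix m m ℂ) fun i =>
    √(hN.1.eigenvalues i) * (√(hN.1.eigenvalues i))⁻¹

section

variable [DecidableEq m] {N : Matrix m m ℂ} (hN : N.PosSemidef)

lemma sqrtPSD_mul_self : sqrtPSD hN * sqrtPSD hN = N := by
  simp_rw [sqrtPSD, ofSpectrum_mul_ofSpectrum (conjTranspose_eigenvectorUnitary_mul_self hN.1),
    Real.mul_self_sqrt (hN.eigenvalues_nonneg _)]
  exact ofSpectrum_eigenvectorUnitary hN.1

lemma sqrtPSD_mul_invSqrtPSD : sqrtPSD hN * invSqrtPSD hN = suppProj hN :=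
  ofSpectrum_mul_ofSpectrum (conjTranspose_eigenvectorUnitary_mul_self hN.1) _ _

lemma invSqrtPSD_mul_sqrtPSD : invSqrtPSD hN * sqrtPSD hN = suppProj hN := by
  refine (ofSpectrum_mul_ofSpectrum (conjTranspose_eigenvectorUnitary_mul_self hN.1) _ _).trans ?_
  simp_rw [suppProj, mul_comm]

lemma isHermitian_invSqrtPSD : (invSqrtPSD hN).IsHermitian := isHermitian_ofSpectrum _ _

lemma isHermitian_sqrtPSD : (sqrtPSD hN).IsHermitian := isHermitian_ofSpectrum _ _

lemma isHermitian_suppProj : (suppProj hN).IsHermitian := isHermitian_ofSpectrum _ _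

lemma sqrtPSD_congr {N' : Matrix m m ℂ} (hN' : N'.PosSemidef) (h : N = N') :
    sqrtPSD hN = sqrtPSD hN' := by
  subst h
  rfl

lemma invSqrtPSD_congr {N' : Matrix m m ℂ} (hN' : N'.PosSemidef) (h : N = N') :
    invSqrtPSD hN = invSqrtPSD hN' := by
  subst h
  rfl

lemma suppProj_mul_self : suppProj hN * suppProj hN = suppProj hN := by
  refine (ofSpectrum_mul_ofSpectrum (conjTranspose_eigenvectorUnitary_mul_self hN.1) _ _).trans ?_
  rw [suppProj]
  congr 1
  ext i
  by_cases h : √(hN.1.eigenvalues i) = 0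
  · simp [h]
  · simp [h]

end

lemma marginalPair_sqrtσ : (marginalPair hM).sqrtσ =
    sqrtPSD (posSemidef_ptraceB hM) ⊗ₖ sqrtPSD (posSemidef_ptraceA hM) := by
  rw [SpectralPair.sqrtσ, sqrtPSD, sqrtPSD, ← ofSpectrum_kronecker]
  simp only [marginalPair, Real.sqrt_mul ((posSemidef_ptraceB hM).eigenvalues_nonneg _)]

lemma marginalPair_invSqrtσ : (marginalPair hM).invSqrtσ =
    invSqrtPSD (posSemidef_ptraceB hM) ⊗ₖ invSqrtPSD (posSemidef_ptraceA hM) := by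
  rw [SpectralPair.invSqrtσ, invSqrtPSD, invSqrtPSD, ← ofSpectrum_kronecker]
  simp only [marginalPair, Real.sqrt_mul ((posSemidef_ptraceB hM).eigenvalues_nonneg _), mul_inv]

lemma marginalPair_relEnt : (marginalPair hM).relEnt = mutInfo M := by
  have hA := posSemidef_ptraceB hM
  have hB := posSemidef_ptraceA hM
  have h1 : (marginalPair hM).relEnt = ∑ i, hM.1.eigenvalues i * Real.log (hM.1.eigenvalues i) -
      ∑ x, marginalWeight hM x * Real.log (hA.1.eigenvalues x.1 * hB.1.eigenvalues x.2) := by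
    simp only [SpectralPair.relEnt, mul_sub, Finset.sum_sub_distrib]
    congr 1
    · rw [Finset.sum_comm]
      refine Finset.sum_congr rfl fun i _ => ?_
      rw [← Finset.sum_mul, ← Finset.mul_sum, SpectralPair.sum_overlap, mul_one]
      rfl
    · refine Finset.sum_congr rfl fun x _ => ?_
      rw [← Finset.sum_mul]
      rfl
  have h2 : ∀ x, marginalWeight hM x * Real.log (hA.1.eigenvalues x.1 * hB.1.eigenvalues x.2) =
      marginalWeight hM x * Real.log (hA.1.eigenvalues x.1) +
        marginalWeight hM x * Real.log (hB.1.eigenvalues x.2) := by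
    intro x
    by_cases hx : hA.1.eigenvalues x.1 * hB.1.eigenvalues x.2 = 0
    · simp [marginalWeight_eq_zero hM x hx]
    · rw [Real.log_mul (left_ne_zero_of_mul hx) (right_ne_zero_of_mul hx), mul_add]
  have h3 : ∑ x : A × B, marginalWeight hM x * Real.log (hA.1.eigenvalues x.1) =
      ∑ a, hA.1.eigenvalues a * Real.log (hA.1.eigenvalues a) := by
    rw [Fintype.sum_prod_type]
    exact Finset.sum_congr rfl fun a _ => (Finset.sum_mul _ _ _).symm.trans
      (congrArg (· * Real.log (hA.1.eigenvalues a)) (sum_marginalWeight_right hM a))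
  have h4 : ∑ x : A × B, marginalWeight hM x * Real.log (hB.1.eigenvalues x.2) =
      ∑ b, hB.1.eigenvalues b * Real.log (hB.1.eigenvalues b) := by
    rw [Fintype.sum_prod_type_right]
    exact Finset.sum_congr rfl fun b _ => (Finset.sum_mul _ _ _).symm.trans
      (congrArg (· * Real.log (hB.1.eigenvalues b)) (sum_marginalWeight_left hM b))
  rw [h1, Finset.sum_congr rfl fun x _ => h2 x, Finset.sum_add_distrib, h3, h4]
  rw [mutInfo, vNent, vNent, vNent, dif_pos hA.1, dif_pos hB.1, dif_pos hM.1]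
  ring

end

/-- Kraus operators that complete a projection to the identity. -/
lemma sum_single_mul_compl [DecidableEq m] (b : B) {P : Matrix m m ℂ} (hP : P.IsHermitian)
    (hPP : P * P = P) :
    ∑ j : m, (Matrix.single b j (1 : ℂ) * (1 - P))ᴴ *
      (Matrix.single b j (1 : ℂ) * (1 - P)) = 1 - P := by
  have h1 : ∀ j : m, (Matrix.single b j (1 : ℂ) * (1 - P))ᴴ *
      (Matrix.single b j (1 : ℂ) * (1 - P)) = (1 - P) * Matrix.single j j 1 * (1 - P) := by
    intro j
    have h : (Matrix.single b j (1 : ℂ))ᴴ * Matrix.single b j (1 : ℂ) = Matrix.single j j 1 := by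
      rw [conjTranspose_single, star_one, single_mul_single_same, one_mul]
    rw [← h, conjTranspose_mul, conjTranspose_sub, hP.eq, conjTranspose_one]
    simp only [Matrix.mul_assoc]
  have h2 : ∑ j : m, Matrix.single j j (1 : ℂ) = 1 := by
    ext i j
    simp [Matrix.sum_apply, Matrix.single_apply, one_apply, ite_and]
  rw [Finset.sum_congr rfl fun j _ => h1 j, ← Finset.sum_mul, ← Finset.mul_sum, h2,
    Matrix.mul_one, Matrix.mul_sub, Matrix.mul_one, Matrix.sub_mul, Matrix.one_mul, hPP, sub_self,
    sub_zero]

/-- Local channels do not increase the mutual information, and one that preserves it can be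
reversed on the state by a local channel. -/
theorem mutInfo_extA {M : Matrix (A × B) (A × B) ℂ} (hM : M.PosSemidef)
    {Φ : Matrix B B ℂ → Matrix B' B' ℂ} (hΦ : IsCPTP Φ) :
    mutInfo (extA (A := A) Φ M) ≤ mutInfo M ∧ (Nonempty B →
      mutInfo (extA (A := A) Φ M) = mutInfo M →
      ∃ R : Matrix B' B' ℂ → Matrix B B ℂ, IsCPTP R ∧ extA (A := A) R (extA Φ M) = M) := by
  have hM' := posSemidef_extA hM hΦ
  obtain ⟨κ, K, hΦK, hK⟩ := hΦ
  rw [funext hΦK] at hM' ⊢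
  have hpB := ptraceB_extA_kraus K hK M
  have hpA := ptraceA_extA_kraus K M
  have hext := extA_kraus K M
  generalize extA (fun Y : Matrix B B ℂ => ∑ k, K k * Y * (K k)ᴴ) M = M' at *
  have hL : ∑ k, ((1 : Matrix A A ℂ) ⊗ₖ K k)ᴴ * ((1 : Matrix A A ℂ) ⊗ₖ K k) = 1 := by
    simp_rw [conjTranspose_kronecker, ← mul_kronecker_mul, conjTranspose_one, Matrix.one_mul]
    rw [← kronecker_finset_sum, hK, one_kronecker_one]
  have key := SpectralPair.relEnt_channel (D := marginalPair hM) (D' := marginalPair hM') hL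
    (by rw [marginalPair_ρ, marginalPair_ρ, hext])
    (by
      rw [marginalPair_σ, marginalPair_σ, hpB, hpA]
      simp_rw [conjTranspose_kronecker, ← mul_kronecker_mul, conjTranspose_one, Matrix.one_mul,
        Matrix.mul_one]
      rw [kronecker_finset_sum])
  have hsupp := (marginalPair hM').invSqrtσ_mul_sqrtσ_mul_rho
  simp only [marginalPair_relEnt, marginalPair_ρ, marginalPair_sqrtσ,
    marginalPair_invSqrtσ, conjTranspose_kronecker, ← mul_kronecker_mul, conjTranspose_one,
    Matrix.mul_one, sqrtPSD_congr (posSemidef_ptraceB hM') (posSemidef_ptraceB hM) hpB,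
    invSqrtPSD_congr (posSemidef_ptraceB hM') (posSemidef_ptraceB hM) hpB,
    invSqrtPSD_mul_sqrtPSD, sqrtPSD_mul_invSqrtPSD] at key hsupp
  refine ⟨key.1, fun _ h => ?_⟩
  replace key := key.2 h
  have hMB' := posSemidef_ptraceA hM'
  have hMB := posSemidef_ptraceA hM
  have hMA := posSemidef_ptraceB hM
  have hP1 : (suppProj hMA ⊗ₖ (1 : Matrix B' B' ℂ)) * M' = M' := by
    conv_lhs => rw [← hsupp, ← Matrix.mul_assoc, ← mul_kronecker_mul, suppProj_mul_self,
      Matrix.one_mul, hsupp]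
  have hP2 : M' * (suppProj hMA ⊗ₖ (1 : Matrix B' B' ℂ)) = M' := by
    have := congrArg conjTranspose hP1
    rwa [conjTranspose_mul, conjTranspose_kronecker, (isHermitian_suppProj hMA).eq,
      conjTranspose_one, hM'.1.eq] at this
  have hQ : ((1 : Matrix A A ℂ) ⊗ₖ suppProj hMB') * M' = M' :=
    calc ((1 : Matrix A A ℂ) ⊗ₖ suppProj hMB') * M'
        = ((1 : Matrix A A ℂ) ⊗ₖ suppProj hMB') * ((suppProj hMA ⊗ₖ suppProj hMB') * M') :=
          congrArg _ hsupp.symm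
      _ = M' := by
          rw [← Matrix.mul_assoc, ← mul_kronecker_mul, suppProj_mul_self, Matrix.one_mul, hsupp]
  let N : Fin κ → Matrix B B' ℂ := fun k => sqrtPSD hMB * (K k)ᴴ * invSqrtPSD hMB'
  let E : B' → Matrix B B' ℂ := fun j =>
    Matrix.single (Classical.arbitrary B) j (1 : ℂ) * (1 - suppProj hMB')
  have hN : ∑ k, (N k)ᴴ * N k = suppProj hMB' := by
    have h1 : ∀ k, (N k)ᴴ * N k =
        invSqrtPSD hMB' * (K k * ptraceA M * (K k)ᴴ) * invSqrtPSD hMB' := fun k => by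
      rw [← sqrtPSD_mul_self hMB]
      simp only [N, conjTranspose_mul, conjTranspose_conjTranspose,
        (isHermitian_sqrtPSD hMB).eq, (isHermitian_invSqrtPSD hMB').eq, Matrix.mul_assoc]
    rw [Finset.sum_congr rfl fun k _ => h1 k, ← Finset.sum_mul, ← Finset.mul_sum, ← hpA]
    conv_lhs =>
      enter [1, 2]
      rw [← sqrtPSD_mul_self hMB']
    rw [← Matrix.mul_assoc, invSqrtPSD_mul_sqrtPSD, Matrix.mul_assoc, sqrtPSD_mul_invSqrtPSD,
      suppProj_mul_self]
  have hE : ∀ j, ((1 : Matrix A A ℂ) ⊗ₖ E j) * M' = 0 := fun j => by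
    have h1 : (1 : Matrix A A ℂ) ⊗ₖ E j =
        ((1 : Matrix A A ℂ) ⊗ₖ Matrix.single (Classical.arbitrary B) j (1 : ℂ)) *
          (1 - (1 : Matrix A A ℂ) ⊗ₖ suppProj hMB') := by
      rw [Matrix.mul_sub, ← mul_kronecker_mul, Matrix.mul_one, Matrix.one_mul]
      ext ⟨a, b⟩ ⟨a', b'⟩
      simp only [E, Matrix.mul_sub, Matrix.mul_one, kroneckerMap_apply, Matrix.sub_apply, mul_sub]
    rw [h1, Matrix.mul_assoc, Matrix.sub_mul, Matrix.one_mul, hQ, sub_self, Matrix.mul_zero]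
  refine ⟨_, isCPTP_of_kraus (Sum.elim N E) ?_, ?_⟩
  · rw [Fintype.sum_sum_type]
    simp only [Sum.elim_inl, Sum.elim_inr]
    rw [hN, sum_single_mul_compl _ (isHermitian_suppProj hMB') (suppProj_mul_self hMB'),
      add_sub_cancel]
  · rw [extA_kraus, Fintype.sum_sum_type]
    simp only [Sum.elim_inl, Sum.elim_inr, hE, Matrix.zero_mul, Finset.sum_const_zero, add_zero]
    refine (Finset.sum_congr rfl fun k _ => ?_).trans key
    have h1 : suppProj hMA ⊗ₖ (sqrtPSD hMB * (K k)ᴴ * invSqrtPSD hMB') =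
        ((1 : Matrix A A ℂ) ⊗ₖ N k) * (suppProj hMA ⊗ₖ (1 : Matrix B' B' ℂ)) := by
      rw [← mul_kronecker_mul, Matrix.one_mul, Matrix.mul_one]
    have h2 : suppProj hMA ⊗ₖ (invSqrtPSD hMB' * K k * sqrtPSD hMB) =
        (suppProj hMA ⊗ₖ (1 : Matrix B' B' ℂ)) * ((1 : Matrix A A ℂ) ⊗ₖ N k)ᴴ := by
      rw [conjTranspose_kronecker, ← mul_kronecker_mul, conjTranspose_one, Matrix.mul_one,
        Matrix.one_mul]
      simp only [N, conjTranspose_mul, conjTranspose_conjTranspose,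
        (isHermitian_sqrtPSD hMB).eq, (isHermitian_invSqrtPSD hMB').eq, Matrix.mul_assoc]
    have h3 : ∀ F : Matrix (A × B) (A × B') ℂ, ∀ P : Matrix (A × B') (A × B') ℂ, P * M' = M' →
        M' * P = M' → F * M' * Fᴴ = F * P * M' * (P * Fᴴ) := fun F P h1 h2 => by
      rw [Matrix.mul_assoc F P M', h1, ← Matrix.mul_assoc, Matrix.mul_assoc F M' P, h2]
    rw [h1, h2]
    exact h3 _ _ hP1 hP2

end Bipartite

end RelativeEntropy

/-- A quantum channel `ℰ : B → B̃` is an exact local compression of a bipartite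
density operator `ρ_{AB}` (i.e. there exists a channel `ℛ : B̃ → B` with
`(id_A ⊗ ℛ)∘(id_A ⊗ ℰ)(ρ) = ρ`) if and only if it preserves the mutual information:
`I(A:B)_ρ = I(A:B̃)_{ℰ(ρ)}`. -/
theorem stmt10
    (A B B' : Type*) [Fintype A] [Fintype B] [Fintype B']
    [DecidableEq A] [DecidableEq B] [DecidableEq B']
    (ρ : Matrix (A × B) (A × B) ℂ) (hρpsd : ρ.PosSemidef) (hρtr : ρ.trace = 1)
    (Φ : Matrix B B ℂ → Matrix B' B' ℂ) (hΦ : IsCPTP Φ) :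
    (∃ R : Matrix B' B' ℂ → Matrix B B ℂ, IsCPTP R ∧ extA (A := A) R (extA Φ ρ) = ρ) ↔
      mutInfo ρ = mutInfo (extA Φ ρ) := by
  have hB : Nonempty B := by
    by_contra hB
    rw [not_nonempty_iff] at hB
    simp [trace] at hρtr
  constructor
  · rintro ⟨R, hR, h⟩
    refine le_antisymm ?_ (mutInfo_extA hρpsd hΦ).1
    have := (mutInfo_extA (posSemidef_extA hρpsd hΦ) hR).1
    rwa [h] at this
  · exact fun h => (mutInfo_extA hρpsd hΦ).2 hB h.symm
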